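/- arXiv:2201.02828 — 6 statements merged into one kernel-verified Lean document; each statement's English description precedes it below -/
import Mathlib

section
/- Fix an integer d ≥ 1, cost vectors c, h ∈ ℝ^d with 0 < c_j < 1 and 0 < h_j < 1 for all j, and set s̃ := (1 − max_j h_j)/(1 + max_j c_j) ∈ (0,1). Define s : S × S → [s̃, 1] by letting s(x, y) be the unique w ∈ [s̃, 1] with F(w, x, y) = 1. Then s is continuous on S × S. -/
open Real Set

noncomputable section

/-- The proportional transaction cost penalty `d(x) = ⟨c,[x]⁺⟩ + ⟨h,[x]⁻⟩`. -/
def penalty {d : ℕ} (c h : Fin d → ℝ) (x : Fin d → ℝ) : ℝ :=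
  (∑ j, c j * max (x j) 0) + (∑ j, h j * max (-(x j)) 0)

/-- `F(w, x, y) = w + d(w·y − x)`. -/
def Ffun {d : ℕ} (c h : Fin d → ℝ) (w : ℝ) (x y : Fin d → ℝ) : ℝ :=
  w + penalty c h (fun j => w * y j - x j)

/-- The contribution of a single coordinate to `F` is strictly increasing in the target position. -/
theorem strictMono_add_cost {a b : ℝ} (ha : 0 ≤ a) (hb : 0 ≤ b) (hb1 : b < 1) (x : ℝ) :
    StrictMono fun t : ℝ => t + (a * max (t - x) 0 + b * max (-(t - x)) 0) := by
  intro t u htu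
  have hpos : a * max (t - x) 0 ≤ a * max (u - x) 0 := by gcongr
  have hneg : max (-(t - x)) 0 ≤ max (-(u - x)) 0 + (u - t) :=
    max_le (by linarith [le_max_left (-(u - x)) 0]) (by linarith [le_max_right (-(u - x)) 0])
  have hneg' := mul_le_mul_of_nonneg_left hneg hb
  have hlt : b * (u - t) < u - t := mul_lt_of_lt_one_left (sub_pos.mpr htu) hb1
  dsimp only
  linarith

theorem Ffun_eq_sum {d : ℕ} (c h : Fin d → ℝ) (w : ℝ) (x : Fin d → ℝ) {y : Fin d → ℝ}
    (hy : ∑ j, y j = 1) :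
    Ffun c h w x y =
      ∑ j, (w * y j + (c j * max (w * y j - x j) 0 + h j * max (-(w * y j - x j)) 0)) := by
  simp only [Ffun, penalty, Finset.sum_add_distrib, ← Finset.mul_sum, hy, mul_one]

theorem strictMono_Ffun {d : ℕ} {c h : Fin d → ℝ} (hc : ∀ j, c j ∈ Ioo (0 : ℝ) 1)
    (hh : ∀ j, h j ∈ Ioo (0 : ℝ) 1) (x : Fin d → ℝ) {y : Fin d → ℝ}
    (hy : y ∈ stdSimplex ℝ (Fin d)) : StrictMono fun w => Ffun c h w x y := by
  intro w v hwv
  simp only [Ffun_eq_sum c h _ x hy.2]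
  have hmono (j : Fin d) := strictMono_add_cost (hc j).1.le (hh j).1.le (hh j).2 (x j)
  obtain ⟨i, -, hi⟩ : ∃ i ∈ Finset.univ, 0 < y i :=
    Finset.exists_lt_of_sum_lt (by simp [hy.2])
  exact Finset.sum_lt_sum
    (fun j _ => (hmono j).monotone (mul_le_mul_of_nonneg_right hwv.le (hy.1 j)))
    ⟨i, Finset.mem_univ i, hmono i (mul_lt_mul_of_pos_right hwv hi)⟩

theorem continuous_Ffun {d : ℕ} (c h : Fin d → ℝ) (w : ℝ) :
    Continuous fun p : (Fin d → ℝ) × (Fin d → ℝ) => Ffun c h w p.1 p.2 := by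
  unfold Ffun penalty
  fun_prop

/-- the capital-decay function `s : S × S → [s̃,1]`, defined by letting
`s(x,y)` be the unique `w ∈ [s̃,1]` with `F(w,x,y) = 1`, is continuous on `S × S`. -/
theorem capital_decay_continuous {d : ℕ} (hd : 0 < d) (c h : Fin d → ℝ)
    (hc : ∀ j, c j ∈ Ioo (0 : ℝ) 1) (hh : ∀ j, h j ∈ Ioo (0 : ℝ) 1)
    (hmax cmax : ℝ)
    (hhmax : hmax = Finset.univ.sup' (Finset.univ_nonempty_iff.mpr ⟨⟨0, hd⟩⟩) h)
    (hcmax : cmax = Finset.univ.sup' (Finset.univ_nonempty_iff.mpr ⟨⟨0, hd⟩⟩) c)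
    (st : ℝ) (hst : st = (1 - hmax) / (1 + cmax))
    (s : (Fin d → ℝ) → (Fin d → ℝ) → ℝ)
    (hs : ∀ x ∈ stdSimplex ℝ (Fin d), ∀ y ∈ stdSimplex ℝ (Fin d),
      s x y ∈ Icc st 1 ∧ Ffun c h (s x y) x y = 1) :
    ContinuousOn (fun p : (Fin d → ℝ) × (Fin d → ℝ) => s p.1 p.2)
      (stdSimplex ℝ (Fin d) ×ˢ stdSimplex ℝ (Fin d)) := by
  intro p hp
  have hmono (q : (Fin d → ℝ) × (Fin d → ℝ))
      (hq : q ∈ stdSimplex ℝ (Fin d) ×ˢ stdSimplex ℝ (Fin d)) :=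
    strictMono_Ffun hc hh q.1 hq.2
  have hsol (q : (Fin d → ℝ) × (Fin d → ℝ))
      (hq : q ∈ stdSimplex ℝ (Fin d) ×ˢ stdSimplex ℝ (Fin d)) :
      Ffun c h (s q.1 q.2) q.1 q.2 = 1 := (hs q.1 hq.1 q.2 hq.2).2
  refine tendsto_order.2 ⟨fun w hw => ?_, fun w hw => ?_⟩
  · have hlt : Ffun c h w p.1 p.2 < 1 := (hmono p hp hw).trans_eq (hsol p hp)
    filter_upwards [self_mem_nhdsWithin, mem_nhdsWithin_of_mem_nhds
      ((continuous_Ffun c h w).continuousAt.eventually_lt_const hlt)] with q hq hqw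
    exact (hmono q hq).lt_iff_lt.1 (hqw.trans_eq (hsol q hq).symm)
  · have hlt : 1 < Ffun c h w p.1 p.2 := (hsol p hp).symm.trans_lt (hmono p hp hw)
    filter_upwards [self_mem_nhdsWithin, mem_nhdsWithin_of_mem_nhds
      ((continuous_Ffun c h w).continuousAt.eventually_const_lt hlt)] with q hq hqw
    exact (hmono q hq).lt_iff_lt.1 ((hsol q hq).trans_lt hqw)
end
end

section
/- Let γ < 0 and let r_1, …, r_d be real random variables on a probability space (Ω, F, P) with E[e^{γ r_i}] < ∞ for every i. Then (1/γ) ln E[e^{γ min_i r_i}] ≥ min_i (1/γ) ln E[e^{γ r_i}] − (ln d)/|γ|; that is, μ^γ(min_i r_i) ≥ min_i μ^γ(r_i) − (ln d)/|γ|. -/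
open MeasureTheory Real Set

noncomputable section

/-- for `γ < 0` and random variables `r_1, …, r_d` with `E[e^{γ r_i}] < ∞`,
`μ^γ(min_i r_i) ≥ min_i μ^γ(r_i) − (ln d)/|γ|`, where `μ^γ(X) = (1/γ) ln E[e^{γX}]`. -/
theorem entropic_min_ge {d : ℕ} (hd : 0 < d) {Ω : Type*} [MeasurableSpace Ω]
    (P : Measure Ω) [IsProbabilityMeasure P]
    (γ : ℝ) (hγ : γ < 0) (r : Fin d → Ω → ℝ)
    (hrm : ∀ i, Measurable (r i))
    (hri : ∀ i, Integrable (fun ω => Real.exp (γ * r i ω)) P) :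
    (1 / γ) * Real.log (∫ ω, Real.exp (γ *
        Finset.univ.inf' (Finset.univ_nonempty_iff.mpr ⟨⟨0, hd⟩⟩) (fun i => r i ω)) ∂P) ≥
      Finset.univ.inf' (Finset.univ_nonempty_iff.mpr ⟨⟨0, hd⟩⟩)
        (fun i => (1 / γ) * Real.log (∫ ω, Real.exp (γ * r i ω) ∂P)) -
        Real.log d / |γ| := by
  set hne : (Finset.univ : Finset (Fin d)).Nonempty :=
    Finset.univ_nonempty_iff.mpr ⟨⟨0, hd⟩⟩
  set m := Finset.univ.inf' hne (fun i => (1 / γ) * Real.log (∫ ω, Real.exp (γ * r i ω) ∂P))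
  have hd' : (0 : ℝ) < d := by exact_mod_cast hd
  have hE : ∀ i, ∫ ω, Real.exp (γ * r i ω) ∂P ≤ Real.exp (γ * m) := by
    intro i
    have hmi : m ≤ (1 / γ) * Real.log (∫ ω, Real.exp (γ * r i ω) ∂P) :=
      Finset.inf'_le _ (Finset.mem_univ i)
    rw [← Real.log_le_iff_le_exp (integral_exp_pos (hri i))]
    have h := mul_le_mul_of_nonpos_left hmi hγ.le
    rwa [← mul_assoc, mul_one_div_cancel hγ.ne, one_mul] at h
  have hsum : Integrable (fun ω => ∑ i, Real.exp (γ * r i ω)) P :=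
    integrable_finsetSum _ fun i _ => hri i
  have hle : ∀ ω, Real.exp (γ * Finset.univ.inf' hne (fun i => r i ω)) ≤
      ∑ i, Real.exp (γ * r i ω) := by
    intro ω
    obtain ⟨i, hi, h⟩ := Finset.exists_mem_eq_inf' hne (fun i => r i ω)
    rw [h]
    exact Finset.single_le_sum (f := fun i => Real.exp (γ * r i ω))
      (fun j _ => (Real.exp_pos _).le) hi
  have hmeas : Measurable (fun ω => Finset.univ.inf' hne (fun i => r i ω)) := by
    have h := Finset.inf'_induction hne r (p := Measurable)
      (fun _ hf _ hg => hf.inf hg) fun i _ => hrm i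
    convert h using 2 with ω
    rw [Finset.inf'_apply]
  have hint : Integrable
      (fun ω => Real.exp (γ * Finset.univ.inf' hne (fun i => r i ω))) P := by
    refine hsum.mono' (hmeas.const_mul γ).exp.aestronglyMeasurable (.of_forall fun ω => ?_)
    rw [Real.norm_of_nonneg (Real.exp_pos _).le]
    exact hle ω
  have hbound : ∫ ω, Real.exp (γ * Finset.univ.inf' hne (fun i => r i ω)) ∂P ≤
      d * Real.exp (γ * m) := calc
    _ ≤ ∫ ω, ∑ i, Real.exp (γ * r i ω) ∂P := integral_mono hint hsum hle
    _ = ∑ i, ∫ ω, Real.exp (γ * r i ω) ∂P := integral_finsetSum _ fun i _ => hri i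
    _ ≤ ∑ _i : Fin d, Real.exp (γ * m) := Finset.sum_le_sum fun i _ => hE i
    _ = d * Real.exp (γ * m) := by simp
  have hlog := Real.log_le_log (integral_exp_pos hint) hbound
  rw [Real.log_mul hd'.ne' (Real.exp_pos _).ne', Real.log_exp] at hlog
  have h := mul_le_mul_of_nonpos_left hlog (one_div_neg.mpr hγ).le
  calc m - Real.log d / |γ| = 1 / γ * (Real.log d + γ * m) := by
        rw [abs_of_neg hγ]
        field_simp [hγ.ne]
        ring
    _ ≤ _ := h
end
end

section
/- Assume (A.1). Then for every δ ∈ [min(γ,0), max(γ,0)] and all π, π' ∈ S, the quantity z_δ(π', π) := μ^δ( ln⟨π, w⟩ + ln s(π', π) ) satisfies z^- ≤ z_δ(π', π) ≤ z^+, where z^- := −|min_i μ^γ(r_i)| − d·max_i E[|r_i|] − (ln d)/|γ| + ln s̃ and z^+ := |max_i μ^γ(r_i)| + d·max_i E[|r_i|] + (ln d)/|γ|. -/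
open MeasureTheory Set

noncomputable section

/-- Standard scalar product on `ℝ^d`. -/
def ip {d : ℕ} (x y : Fin d → ℝ) : ℝ := ∑ i, x i * y i

/-- Entropic utility `μ^γ(X) = (1/γ) ln E[e^{γX}]`, with the convention `μ^0 = E`. -/
def entropic0 {Ω : Type*} [MeasurableSpace Ω] (γ : ℝ) (P : Measure Ω) (X : Ω → ℝ) : ℝ :=
  if γ = 0 then ∫ ω, X ω ∂P else (1 / γ) * Real.log (∫ ω, Real.exp (γ * X ω) ∂P)

section EntropicUtility

lemma mul_entropic0_self {Ω : Type*} [MeasurableSpace Ω] {P : Measure Ω} {γ : ℝ}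
    (hγ : γ ≠ 0) (X : Ω → ℝ) :
    γ * entropic0 γ P X = Real.log (∫ ω, Real.exp (γ * X ω) ∂P) := by
  rw [entropic0, if_neg hγ, ← mul_assoc, mul_one_div_cancel hγ, one_mul]

variable {Ω : Type*} [MeasurableSpace Ω] {P : Measure Ω} [IsProbabilityMeasure P]

/-- The exponential is convex: compare `exp (t * x)` with the chord from `0` to `x`. -/
lemma exp_mul_le_chord (x : ℝ) {t : ℝ} (ht0 : 0 ≤ t) (ht1 : t ≤ 1) :
    Real.exp (t * x) ≤ t * Real.exp x + (1 - t) := by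
  have h := convexOn_exp.2 (mem_univ x) (mem_univ 0) ht0 (sub_nonneg.2 ht1) (by ring)
  simpa using h

lemma integrable_exp_mul_of_integrable_exp {u : Ω → ℝ} (hu : Integrable u P)
    (hexp : Integrable (fun ω => Real.exp (u ω)) P) {t : ℝ} (ht0 : 0 ≤ t) (ht1 : t ≤ 1) :
    Integrable (fun ω => Real.exp (t * u ω)) P := by
  refine ((hexp.const_mul t).add (integrable_const (1 - t))).mono'
    (Real.continuous_exp.comp_aestronglyMeasurable (hu.aestronglyMeasurable.const_mul t)) ?_
  filter_upwards with ω
  rw [Real.norm_of_nonneg (Real.exp_pos _).le]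
  exact exp_mul_le_chord _ ht0 ht1

lemma integral_le_log_integral_exp {u : Ω → ℝ} (hu : Integrable u P)
    (hexp : Integrable (fun ω => Real.exp (u ω)) P) :
    ∫ ω, u ω ∂P ≤ Real.log (∫ ω, Real.exp (u ω) ∂P) := by
  rw [Real.le_log_iff_exp_le (integral_exp_pos hexp)]
  simpa using convexOn_exp.map_integral_le Real.continuous_exp.continuousOn isClosed_univ
    (by simp) hu hexp

lemma log_integral_exp_mul_le {u : Ω → ℝ} (hu : Integrable u P)
    (hexp : Integrable (fun ω => Real.exp (u ω)) P) {t : ℝ} (ht0 : 0 ≤ t) (ht1 : t ≤ 1) :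
    Real.log (∫ ω, Real.exp (t * u ω) ∂P) ≤ t * Real.log (∫ ω, Real.exp (u ω) ∂P) := by
  have hpos := integral_exp_pos hexp
  have ht := integrable_exp_mul_of_integrable_exp hu hexp ht0 ht1
  set a := Real.log (∫ ω, Real.exp (u ω) ∂P) with ha
  have hea : Real.exp a = ∫ ω, Real.exp (u ω) ∂P := Real.exp_log hpos
  have hpt : ∀ ω, Real.exp (t * u ω) ≤
      Real.exp (t * a) * (t * (Real.exp (-a) * Real.exp (u ω)) + (1 - t)) := fun ω => by
    have h := mul_le_mul_of_nonneg_left (exp_mul_le_chord (-a + u ω) ht0 ht1)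
      (Real.exp_pos (t * a)).le
    rwa [← Real.exp_add, show t * a + t * (-a + u ω) = t * u ω by ring, Real.exp_add (-a)] at h
  have hI : Integrable (fun ω => t * (Real.exp (-a) * Real.exp (u ω))) P :=
    (hexp.const_mul _).const_mul _
  have h := integral_mono ht ((hI.add (integrable_const (1 - t))).const_mul (Real.exp (t * a))) hpt
  rw [integral_const_mul] at h
  simp only [Pi.add_apply] at h
  rw [integral_add hI (integrable_const _), integral_const_mul,
    integral_const_mul, ← hea, ← Real.exp_add] at h
  rw [Real.log_le_iff_le_exp (integral_exp_pos ht)]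
  simpa using h

/-- Monotonicity of the entropic utility in the risk parameter, on the segment from `0` to `γ`. -/
lemma mul_entropic0_mem_Icc {X : Ω → ℝ} {γ t : ℝ} (hγ : γ ≠ 0) (hX : Integrable X P)
    (hexp : Integrable (fun ω => Real.exp (γ * X ω)) P) (ht0 : 0 ≤ t) (ht1 : t ≤ 1) :
    γ * entropic0 (t * γ) P X ∈ Icc (γ * ∫ ω, X ω ∂P) (γ * entropic0 γ P X) := by
  have hu : Integrable (fun ω => γ * X ω) P := hX.const_mul γ
  rw [mul_entropic0_self hγ]
  rcases ht0.eq_or_lt with rfl | htpos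
  · have h := integral_le_log_integral_exp hu hexp
    rw [integral_const_mul] at h
    simpa [entropic0] using h
  · have hlow := integral_le_log_integral_exp (hu.const_mul t)
      (integrable_exp_mul_of_integrable_exp hu hexp ht0 ht1)
    have hupp := log_integral_exp_mul_le hu hexp ht0 ht1
    have hself := mul_entropic0_self (P := P) (mul_ne_zero htpos.ne' hγ) X
    simp only [← mul_assoc] at hlow hupp
    rw [← hself, integral_const_mul, mul_assoc, mul_assoc] at hlow
    rw [← hself, mul_assoc] at hupp
    exact ⟨le_of_mul_le_mul_left hlow htpos, le_of_mul_le_mul_left hupp htpos⟩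

end EntropicUtility

section LogIp

variable {d : ℕ} {π : Fin d → ℝ}

lemma exists_pos_of_mem_stdSimplex (hπ : π ∈ stdSimplex ℝ (Fin d)) : ∃ i, 0 < π i := by
  by_contra! h
  have hsum := Finset.sum_nonpos fun i (_ : i ∈ Finset.univ) => h i
  linarith [hπ.2]

lemma ip_exp_pos (hπ : π ∈ stdSimplex ℝ (Fin d)) (x : Fin d → ℝ) :
    0 < ip π (fun i => Real.exp (x i)) := by
  obtain ⟨i, hi⟩ := exists_pos_of_mem_stdSimplex hπ
  exact Finset.sum_pos' (fun j _ => mul_nonneg (hπ.1 j) (Real.exp_pos _).le)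
    ⟨i, Finset.mem_univ i, mul_pos hi (Real.exp_pos _)⟩

lemma exists_log_ip_exp_le (hπ : π ∈ stdSimplex ℝ (Fin d)) (x : Fin d → ℝ) :
    ∃ i, Real.log (ip π (fun i => Real.exp (x i))) ≤ x i := by
  by_contra! h
  set L := Real.log (ip π (fun i => Real.exp (x i)))
  have hL : Real.exp L = ∑ i, π i * Real.exp (x i) := Real.exp_log (ip_exp_pos hπ x)
  obtain ⟨i, hi⟩ := exists_pos_of_mem_stdSimplex hπ
  have hlt : ∑ i, π i * Real.exp (x i) < ∑ i, π i * Real.exp L :=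
    Finset.sum_lt_sum
      (fun j _ => mul_le_mul_of_nonneg_left (Real.exp_le_exp.2 (h j).le) (hπ.1 j))
      ⟨i, Finset.mem_univ i, mul_lt_mul_of_pos_left (Real.exp_lt_exp.2 (h i)) hi⟩
  rw [← Finset.sum_mul, hπ.2, one_mul, hL] at hlt
  exact hlt.false

lemma exists_le_log_ip_exp (hπ : π ∈ stdSimplex ℝ (Fin d)) (x : Fin d → ℝ) :
    ∃ i, x i ≤ Real.log (ip π (fun i => Real.exp (x i))) := by
  by_contra! h
  set L := Real.log (ip π (fun i => Real.exp (x i)))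
  have hL : Real.exp L = ∑ i, π i * Real.exp (x i) := Real.exp_log (ip_exp_pos hπ x)
  obtain ⟨i, hi⟩ := exists_pos_of_mem_stdSimplex hπ
  have hlt : ∑ i, π i * Real.exp L < ∑ i, π i * Real.exp (x i) :=
    Finset.sum_lt_sum
      (fun j _ => mul_le_mul_of_nonneg_left (Real.exp_le_exp.2 (h j).le) (hπ.1 j))
      ⟨i, Finset.mem_univ i, mul_lt_mul_of_pos_left (Real.exp_lt_exp.2 (h i)) hi⟩
  rw [← Finset.sum_mul, hπ.2, one_mul, hL] at hlt
  exact hlt.false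

lemma abs_log_ip_exp_le_sum (hπ : π ∈ stdSimplex ℝ (Fin d)) (x : Fin d → ℝ) :
    |Real.log (ip π (fun i => Real.exp (x i)))| ≤ ∑ i, |x i| := by
  have hsum : ∀ i, |x i| ≤ ∑ i, |x i| := fun i =>
    Finset.single_le_sum (f := fun i => |x i|) (fun j _ => abs_nonneg _) (Finset.mem_univ i)
  obtain ⟨i, hi⟩ := exists_log_ip_exp_le hπ x
  obtain ⟨j, hj⟩ := exists_le_log_ip_exp hπ x
  exact abs_le.2 ⟨by linarith [neg_abs_le (x j), hsum j], by linarith [le_abs_self (x i), hsum i]⟩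

lemma exp_mul_log_ip_exp_le_sum (hπ : π ∈ stdSimplex ℝ (Fin d)) (γ : ℝ) (x : Fin d → ℝ) :
    Real.exp (γ * Real.log (ip π (fun i => Real.exp (x i)))) ≤ ∑ i, Real.exp (γ * x i) := by
  have key : ∃ i, γ * Real.log (ip π (fun i => Real.exp (x i))) ≤ γ * x i := by
    rcases le_total 0 γ with hγ | hγ
    · obtain ⟨i, hi⟩ := exists_log_ip_exp_le hπ x
      exact ⟨i, mul_le_mul_of_nonneg_left hi hγ⟩
    · obtain ⟨i, hi⟩ := exists_le_log_ip_exp hπ x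
      exact ⟨i, mul_le_mul_of_nonpos_left hi hγ⟩
  obtain ⟨i, hi⟩ := key
  exact (Real.exp_le_exp.2 hi).trans (Finset.single_le_sum (f := fun i => Real.exp (γ * x i))
    (fun j _ => (Real.exp_pos _).le) (Finset.mem_univ i))

lemma measurable_log_ip_exp {Ω : Type*} [MeasurableSpace Ω] {r : Ω → Fin d → ℝ}
    (hr : Measurable r) :
    Measurable (fun ω => Real.log (ip π (fun i => Real.exp (r ω i)))) := by
  unfold ip
  fun_prop

end LogIp

section Portfolio

variable {d : ℕ} {π : Fin d → ℝ} {Ω : Type*} [MeasurableSpace Ω] {P : Measure Ω}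
  {r : Ω → Fin d → ℝ}

lemma integrable_log_ip_exp (hπ : π ∈ stdSimplex ℝ (Fin d)) (hrm : Measurable r)
    (hint : ∀ i, Integrable (fun ω => r ω i) P) :
    Integrable (fun ω => Real.log (ip π (fun i => Real.exp (r ω i)))) P :=
  (integrable_finsetSum Finset.univ fun i _ => (hint i).abs).mono'
    (measurable_log_ip_exp hrm).aestronglyMeasurable
    (Filter.Eventually.of_forall fun ω => abs_log_ip_exp_le_sum hπ (r ω))

lemma abs_integral_log_ip_exp_le (hπ : π ∈ stdSimplex ℝ (Fin d))
    (hint : ∀ i, Integrable (fun ω => r ω i) P) {M : ℝ} (hM : ∀ i, ∫ ω, |r ω i| ∂P ≤ M) :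
    |∫ ω, Real.log (ip π (fun i => Real.exp (r ω i))) ∂P| ≤ d * M := by
  have h := norm_integral_le_of_norm_le (f := fun ω => Real.log (ip π fun i => Real.exp (r ω i)))
    (integrable_finsetSum Finset.univ fun i _ => (hint i).abs)
    (Filter.Eventually.of_forall fun ω => abs_log_ip_exp_le_sum hπ (r ω))
  rw [integral_finsetSum _ fun i _ => (hint i).abs] at h
  exact h.trans ((Finset.sum_le_sum fun i _ => hM i).trans (by simp))

lemma integrable_exp_mul_log_ip_exp (hπ : π ∈ stdSimplex ℝ (Fin d)) (hrm : Measurable r) {γ : ℝ}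
    (hexp : ∀ i, Integrable (fun ω => Real.exp (γ * r ω i)) P) :
    Integrable (fun ω => Real.exp (γ * Real.log (ip π (fun i => Real.exp (r ω i))))) P := by
  refine (integrable_finsetSum Finset.univ fun i _ => hexp i).mono'
    ((measurable_log_ip_exp hrm).const_mul γ).exp.aestronglyMeasurable ?_
  filter_upwards with ω
  rw [Real.norm_of_nonneg (Real.exp_pos _).le]
  exact exp_mul_log_ip_exp_le_sum hπ γ (r ω)

lemma exists_log_integral_exp_mul_log_ip_exp_le [IsProbabilityMeasure P] (hd : 0 < d)
    (hπ : π ∈ stdSimplex ℝ (Fin d)) (hrm : Measurable r) {γ : ℝ}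
    (hexp : ∀ i, Integrable (fun ω => Real.exp (γ * r ω i)) P) :
    ∃ i, Real.log (∫ ω, Real.exp (γ * Real.log (ip π (fun i => Real.exp (r ω i)))) ∂P) ≤
      Real.log d + Real.log (∫ ω, Real.exp (γ * r ω i) ∂P) := by
  have : Nonempty (Fin d) := ⟨⟨0, hd⟩⟩
  obtain ⟨i, hi⟩ := Finite.exists_max fun i => ∫ ω, Real.exp (γ * r ω i) ∂P
  refine ⟨i, ?_⟩
  have hL := integrable_exp_mul_log_ip_exp hπ hrm hexp
  have h := integral_mono hL (integrable_finsetSum Finset.univ fun i _ => hexp i)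
    fun ω => exp_mul_log_ip_exp_le_sum hπ γ (r ω)
  rw [integral_finsetSum _ fun i _ => hexp i] at h
  rw [← Real.log_mul (by positivity) (integral_exp_pos (hexp i)).ne']
  exact Real.log_le_log (integral_exp_pos hL)
    (h.trans ((Finset.sum_le_sum fun j _ => hi j).trans (by simp)))

/-- The entropic utility is translation equivariant. -/
lemma entropic0_add_const [IsProbabilityMeasure P] {δ : ℝ} {X : Ω → ℝ} (hX : Integrable X P)
    (hexp : Integrable (fun ω => Real.exp (δ * X ω)) P) (c : ℝ) :
    entropic0 δ P (fun ω => X ω + c) = entropic0 δ P X + c := by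
  unfold entropic0
  split_ifs with hδ
  · rw [integral_add hX (integrable_const c)]
    simp
  · simp only [mul_add, Real.exp_add]
    rw [integral_mul_const, Real.log_mul (integral_exp_pos hexp).ne' (Real.exp_pos _).ne',
      Real.log_exp]
    field_simp

end Portfolio

lemma exists_mul_eq_of_mem_Icc_min_max {γ δ : ℝ}
    (hδ : δ ∈ Icc (min γ 0) (max γ 0)) : ∃ t, 0 ≤ t ∧ t ≤ 1 ∧ t * γ = δ := by
  have h : δ ∈ segment ℝ 0 γ := by rwa [segment_eq_uIcc, uIcc_comm]
  obtain ⟨a, t, ha, ht, hat, rfl⟩ := h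
  exact ⟨t, ht, by linarith, by simp⟩

/-- Lemma `lm:z.bounds`: under (A.1), for every `δ` between `γ` and `0`
and all `π, π' ∈ S`, the quantity `z_δ(π',π) = μ^δ(ln⟨π,w⟩ + ln s(π',π))` satisfies
`z⁻ ≤ z_δ(π',π) ≤ z⁺`. -/
theorem z_bounds {d : ℕ} (hd : 0 < d) {Ω : Type*} [MeasurableSpace Ω]
    (P : Measure Ω) [IsProbabilityMeasure P]
    (st : ℝ) (hst : st ∈ Ioo (0 : ℝ) 1)
    (s : (Fin d → ℝ) → (Fin d → ℝ) → ℝ)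
    (hs : ∀ x ∈ stdSimplex ℝ (Fin d), ∀ y ∈ stdSimplex ℝ (Fin d), s x y ∈ Icc st 1)
    (hscont : ContinuousOn (fun p : (Fin d → ℝ) × (Fin d → ℝ) => s p.1 p.2)
      (stdSimplex ℝ (Fin d) ×ˢ stdSimplex ℝ (Fin d)))
    (γ : ℝ) (hγ : γ ≠ 0) (r : Ω → Fin d → ℝ) (hrm : Measurable r)
    (hA1exp : ∀ i, Integrable (fun ω => Real.exp (γ * r ω i)) P)
    (hA1int : ∀ i, Integrable (fun ω => r ω i) P)
    (zminus zplus : ℝ)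
    (hzminus : zminus =
      -|Finset.univ.inf' (Finset.univ_nonempty_iff.mpr ⟨⟨0, hd⟩⟩)
          (fun i => entropic0 γ P (fun ω => r ω i))| -
        d * Finset.univ.sup' (Finset.univ_nonempty_iff.mpr ⟨⟨0, hd⟩⟩)
          (fun i => ∫ ω, |r ω i| ∂P) -
        Real.log d / |γ| + Real.log st)
    (hzplus : zplus =
      |Finset.univ.sup' (Finset.univ_nonempty_iff.mpr ⟨⟨0, hd⟩⟩)
          (fun i => entropic0 γ P (fun ω => r ω i))| +
        d * Finset.univ.sup' (Finset.univ_nonempty_iff.mpr ⟨⟨0, hd⟩⟩)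
          (fun i => ∫ ω, |r ω i| ∂P) +
        Real.log d / |γ|) :
    ∀ δ ∈ Icc (min γ 0) (max γ 0), ∀ π ∈ stdSimplex ℝ (Fin d), ∀ π' ∈ stdSimplex ℝ (Fin d),
      zminus ≤ entropic0 δ P
          (fun ω => Real.log (ip π (fun i => Real.exp (r ω i))) + Real.log (s π' π)) ∧
        entropic0 δ P
          (fun ω => Real.log (ip π (fun i => Real.exp (r ω i))) + Real.log (s π' π)) ≤
          zplus := by
  subst hzminus hzplus
  intro δ hδ π hπ π' hπ'
  obtain ⟨t, ht0, ht1, rfl⟩ := exists_mul_eq_of_mem_Icc_min_max hδ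
  obtain ⟨hs1, hs2⟩ := hs π' hπ' π hπ
  have hc1 : Real.log st ≤ Real.log (s π' π) := Real.log_le_log hst.1 hs1
  have hc2 : Real.log (s π' π) ≤ 0 := Real.log_nonpos (hst.1.le.trans hs1) hs2
  have hst0 : Real.log st ≤ 0 := hc1.trans hc2
  have hd0 : 0 ≤ Real.log d / |γ| := div_nonneg (Real.log_natCast_nonneg d) (abs_nonneg γ)
  have hL := integrable_log_ip_exp hπ hrm hA1int
  have hE := integrable_exp_mul_log_ip_exp hπ hrm hA1exp
  have hEt := integrable_exp_mul_of_integrable_exp (hL.const_mul γ) hE ht0 ht1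
  simp only [← mul_assoc] at hEt
  rw [entropic0_add_const hL hEt]
  obtain ⟨hlow, hupp⟩ := mul_entropic0_mem_Icc hγ hL hE ht0 ht1
  have hmean := abs_le.1 (abs_integral_log_ip_exp_le hπ hA1int
    (M := Finset.univ.sup' (Finset.univ_nonempty_iff.mpr ⟨⟨0, hd⟩⟩) fun i => ∫ ω, |r ω i| ∂P)
    fun i => Finset.le_sup' (fun i => ∫ ω, |r ω i| ∂P) (Finset.mem_univ i))
  have hdM := (abs_nonneg _).trans (abs_le.2 hmean)
  obtain ⟨i, hi⟩ := exists_log_integral_exp_mul_log_ip_exp_le hd hπ hrm hA1exp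
  rw [← mul_entropic0_self hγ, ← mul_entropic0_self hγ] at hi
  have hinf := Finset.inf'_le (fun i => entropic0 γ P (fun ω => r ω i)) (Finset.mem_univ i)
  have hsup := Finset.le_sup' (fun i => entropic0 γ P (fun ω => r ω i)) (Finset.mem_univ i)
  have hinf' := neg_abs_le (Finset.univ.inf' (Finset.univ_nonempty_iff.mpr ⟨⟨0, hd⟩⟩)
    (fun i => entropic0 γ P (fun ω => r ω i)))
  have hsup' := le_abs_self (Finset.univ.sup' (Finset.univ_nonempty_iff.mpr ⟨⟨0, hd⟩⟩)
    (fun i => entropic0 γ P (fun ω => r ω i)))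
  have hinf0 := abs_nonneg (Finset.univ.inf' (Finset.univ_nonempty_iff.mpr ⟨⟨0, hd⟩⟩)
    (fun i => entropic0 γ P (fun ω => r ω i)))
  have hsup0 := abs_nonneg (Finset.univ.sup' (Finset.univ_nonempty_iff.mpr ⟨⟨0, hd⟩⟩)
    (fun i => entropic0 γ P (fun ω => r ω i)))
  have htot := hupp.trans hi
  rcases hγ.lt_or_gt with hneg | hpos
  · have hEle := (mul_le_mul_left_of_neg hneg).1 hlow
    rw [show Real.log d = γ * -(Real.log d / |γ|) by rw [abs_of_neg hneg]; field_simp,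
      ← mul_add] at htot
    have hge := (mul_le_mul_left_of_neg hneg).1 htot
    constructor <;> linarith
  · have hEle := le_of_mul_le_mul_left hlow hpos
    rw [show Real.log d = γ * (Real.log d / |γ|) by rw [abs_of_pos hpos]; field_simp,
      ← mul_add] at htot
    have hle := le_of_mul_le_mul_left htot hpos
    constructor <;> linarith
end
end

section
/- Assume (A.1). Then for each α > 0 there exists a bounded continuous function v_α : S × Γ → ℝ satisfying the discounted Bellman equation: for every π ∈ S and δ ∈ Γ, v_α(π, δ) = δ · sup_{π' ∈ S} μ^δ( ln⟨π', w⟩ + ln s(π, π') + δ^{-1} v_α(G(π', w), δ e^{-α}) ); equivalently, e^{v_α(π, δ)} = opt_{π' ∈ S} e^{δ ln s(π, π')} E[ e^{δ ln⟨π', w⟩ + v_α(G(π', w), δ e^{-α})} ], with opt = inf if δ < 0 and opt = sup if δ > 0. -/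
open MeasureTheory Set

noncomputable section

/-- `G(x,y) = (x·y)/⟨x,y⟩` (componentwise product, normalised). -/
def Gmap {d : ℕ} (x y : Fin d → ℝ) : Fin d → ℝ := fun i => x i * y i / ip x y

/-- Entropic utility `μ^γ(X) = (1/γ) ln E[e^{γX}]`. -/
def entropic {Ω : Type*} [MeasurableSpace Ω] (γ : ℝ) (P : Measure Ω) (X : Ω → ℝ) : ℝ :=
  (1 / γ) * Real.log (∫ ω, Real.exp (γ * X ω) ∂P)

/-- The parameter set `Γ = [min(γ,0), max(γ,0)] \ {0}`. -/
def Gam (γ : ℝ) : Set ℝ := Icc (min γ 0) (max γ 0) \ {0}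

/-- The discounted Bellman operator
`(Tv)(π,δ) = δ ⨆_{π' ∈ S} μ^δ(ln⟨π',w⟩ + ln s(π,π') + δ⁻¹ v(G(π',w), δe^{-α}))`. -/
def TOp {d : ℕ} {Ω : Type*} [MeasurableSpace Ω] (P : Measure Ω)
    (s : (Fin d → ℝ) → (Fin d → ℝ) → ℝ) (r : Ω → Fin d → ℝ) (α : ℝ)
    (v : (Fin d → ℝ) → ℝ → ℝ) : (Fin d → ℝ) → ℝ → ℝ :=
  fun π δ => δ * sSup ((fun π' => entropic δ P (fun ω =>
      Real.log (ip π' (fun i => Real.exp (r ω i))) + Real.log (s π π') +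
        δ⁻¹ * v (Gmap π' (fun i => Real.exp (r ω i))) (δ * Real.exp (-α)))) ''
      stdSimplex ℝ (Fin d))

/-- Supremum norm over `S × Γ`. -/
def supNormSG {d : ℕ} (γ : ℝ) (f : (Fin d → ℝ) → ℝ → ℝ) : ℝ :=
  sSup {y | ∃ π ∈ stdSimplex ℝ (Fin d), ∃ δ ∈ Gam γ, y = |f π δ|}

section EntropicUtility

variable {Ω : Type*} [MeasurableSpace Ω] {P : Measure Ω} [IsProbabilityMeasure P]

/-- The entropic utility is monotone and translation invariant. -/
lemma entropic_le_entropic_add {δ c : ℝ} (hδ : δ ≠ 0) {X Y : Ω → ℝ}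
    (hX : Integrable (fun ω => Real.exp (δ * X ω)) P)
    (hY : Integrable (fun ω => Real.exp (δ * Y ω)) P) (h : ∀ ω, X ω ≤ Y ω + c) :
    entropic δ P X ≤ entropic δ P Y + c := by
  have hXp := integral_exp_pos hX
  have hYp := integral_exp_pos hY
  have hlog : Real.log (Real.exp (δ * c) * ∫ ω, Real.exp (δ * Y ω) ∂P) =
      δ * c + Real.log (∫ ω, Real.exp (δ * Y ω) ∂P) := by
    rw [Real.log_mul (Real.exp_pos _).ne' hYp.ne', Real.log_exp]
  have hsplit : entropic δ P Y + c =
      1 / δ * Real.log (Real.exp (δ * c) * ∫ ω, Real.exp (δ * Y ω) ∂P) := by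
    rw [hlog, entropic]; field_simp; ring
  rw [hsplit, entropic, ← integral_const_mul]
  have hcY : Integrable (fun ω => Real.exp (δ * c) * Real.exp (δ * Y ω)) P := hY.const_mul _
  have hcYp : 0 < ∫ ω, Real.exp (δ * c) * Real.exp (δ * Y ω) ∂P := by
    rw [integral_const_mul]; positivity
  rcases hδ.lt_or_gt with hneg | hpos
  · refine mul_le_mul_of_nonpos_left ?_ (one_div_neg.2 hneg).le
    refine Real.log_le_log hcYp (integral_mono hcY hX fun ω => ?_)
    simp only [← Real.exp_add]
    exact Real.exp_le_exp.2 (by nlinarith [h ω])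
  · refine mul_le_mul_of_nonneg_left ?_ (one_div_pos.2 hpos).le
    refine Real.log_le_log hXp (integral_mono hX hcY fun ω => ?_)
    simp only [← Real.exp_add]
    exact Real.exp_le_exp.2 (by nlinarith [h ω])

lemma abs_entropic_sub_entropic_le {δ c : ℝ} (hδ : δ ≠ 0) {X Y : Ω → ℝ}
    (hX : Integrable (fun ω => Real.exp (δ * X ω)) P)
    (hY : Integrable (fun ω => Real.exp (δ * Y ω)) P) (h : ∀ ω, |X ω - Y ω| ≤ c) :
    |entropic δ P X - entropic δ P Y| ≤ c := by
  rw [abs_sub_le_iff]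
  constructor
  · linarith [entropic_le_entropic_add (c := c) hδ hX hY fun ω => by
      linarith [(abs_le.1 (h ω)).2]]
  · linarith [entropic_le_entropic_add (c := c) hδ hY hX fun ω => by
      linarith [(abs_le.1 (h ω)).1]]

/-- Jensen's lower bound for the cumulant generating function. -/
lemma mul_integral_le_log_integral_exp {t : ℝ} {Z : Ω → ℝ} (hZ : Integrable Z P)
    (htZ : Integrable (fun ω => Real.exp (t * Z ω)) P) :
    t * ∫ ω, Z ω ∂P ≤ Real.log (∫ ω, Real.exp (t * Z ω) ∂P) := by
  rw [Real.le_log_iff_exp_le (integral_exp_pos htZ)]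
  set m := ∫ ω, Z ω ∂P with hm
  have hlin : Integrable (fun ω => t * (Z ω - m) + 1) P :=
    ((hZ.sub (integrable_const m)).const_mul t).add (integrable_const 1)
  have hint : ∫ ω, Real.exp (t * m) * (t * (Z ω - m) + 1) ∂P = Real.exp (t * m) := by
    have hsub : Integrable (fun ω => Z ω - m) P := hZ.sub (integrable_const m)
    rw [integral_const_mul, integral_add (hsub.const_mul t) (integrable_const 1),
      integral_const_mul, integral_sub hZ (integrable_const m)]
    simp [← hm]
  rw [← hint]
  refine integral_mono (hlin.const_mul _) htZ fun ω => ?_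
  calc Real.exp (t * m) * (t * (Z ω - m) + 1)
      ≤ Real.exp (t * m) * Real.exp (t * (Z ω - m)) :=
        mul_le_mul_of_nonneg_left (Real.add_one_le_exp _) (Real.exp_pos _).le
    _ = Real.exp (t * Z ω) := by rw [← Real.exp_add]; ring_nf

/-- Jensen's upper bound for the cumulant generating function. -/
lemma log_integral_exp_le_mul_log {t M : ℝ} (ht : 0 ≤ t) (ht1 : t ≤ 1) {Z : Ω → ℝ}
    (hZ : Integrable (fun ω => Real.exp (Z ω)) P)
    (htZ : Integrable (fun ω => Real.exp (t * Z ω)) P) (hM : ∫ ω, Real.exp (Z ω) ∂P ≤ M) :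
    Real.log (∫ ω, Real.exp (t * Z ω) ∂P) ≤ t * Real.log M := by
  have hMpos : 0 < M := (integral_exp_pos hZ).trans_le hM
  rw [Real.log_le_iff_le_exp (integral_exp_pos htZ)]
  have hpt : ∀ ω, Real.exp (t * Z ω) ≤
      Real.exp (t * Real.log M) * ((1 - t) + t / M * Real.exp (Z ω)) := fun ω => by
    have hconv := convexOn_exp.2 (mem_univ 0) (mem_univ (Z ω - Real.log M))
      (sub_nonneg.2 ht1) ht (by ring)
    simp only [smul_eq_mul, mul_zero, zero_add, Real.exp_zero, mul_one, Real.exp_sub,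
      Real.exp_log hMpos] at hconv
    calc Real.exp (t * Z ω)
        = Real.exp (t * Real.log M) * Real.exp (t * (Z ω - Real.log M)) := by
          rw [← Real.exp_add]; ring_nf
      _ ≤ Real.exp (t * Real.log M) * ((1 - t) + t * (Real.exp (Z ω) / M)) :=
          mul_le_mul_of_nonneg_left hconv (Real.exp_pos _).le
      _ = _ := by ring
  have hint : Integrable (fun ω => (1 - t) + t / M * Real.exp (Z ω)) P :=
    (integrable_const _).add (hZ.const_mul _)
  refine (integral_mono htZ (hint.const_mul _) hpt).trans ?_
  rw [integral_const_mul, integral_add (integrable_const _) (hZ.const_mul _),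
    integral_const_mul]
  refine mul_le_of_le_one_right (Real.exp_pos _).le ?_
  have : t / M * ∫ ω, Real.exp (Z ω) ∂P ≤ t / M * M :=
    mul_le_mul_of_nonneg_left hM (by positivity)
  rw [div_mul_cancel₀ _ hMpos.ne'] at this
  simp only [integral_const, probReal_univ, one_smul]
  linarith

/-- Joint continuity of the entropic utility in its parameter and its argument. -/
lemma continuous_entropic {X : Type*} [TopologicalSpace X] [FirstCountableTopology X]
    {D : X → ℝ} (hD : Continuous D) (hD0 : ∀ x, D x ≠ 0) {Φ : X → Ω → ℝ}
    (hΦm : ∀ x, Measurable (Φ x)) (hΦc : ∀ ω, Continuous fun x => Φ x ω) {b : Ω → ℝ}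
    (hb : Integrable b P) (hΦb : ∀ x ω, Real.exp (D x * Φ x ω) ≤ b ω) :
    Continuous fun x => entropic (D x) P (Φ x) := by
  have hm : ∀ x, AEStronglyMeasurable (fun ω => Real.exp (D x * Φ x ω)) P := fun x =>
    (Real.measurable_exp.comp ((hΦm x).const_mul _)).aestronglyMeasurable
  have hbd : ∀ x, ∀ᵐ ω ∂P, ‖Real.exp (D x * Φ x ω)‖ ≤ b ω := fun x =>
    Filter.Eventually.of_forall fun ω => by
      rw [Real.norm_eq_abs, Real.abs_exp]; exact hΦb x ω
  have hcont : Continuous fun x => ∫ ω, Real.exp (D x * Φ x ω) ∂P :=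
    continuous_of_dominated hm hbd hb <| Filter.Eventually.of_forall fun ω =>
      Real.continuous_exp.comp (hD.mul (hΦc ω))
  exact (continuous_const.div hD hD0).mul
    (hcont.log fun x => (integral_exp_pos (hb.mono' (hm x) (hbd x))).ne')

end EntropicUtility

section Portfolio

variable {d : ℕ}

lemma exists_eq_mul_of_mem_Gam {γ δ : ℝ} (h : δ ∈ Gam γ) : ∃ t, 0 < t ∧ t ≤ 1 ∧ δ = t * γ := by
  obtain ⟨⟨h1, h2⟩, h0 : δ ≠ 0⟩ := h
  rcases lt_trichotomy γ 0 with hγ | rfl | hγ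
  · rw [min_eq_left hγ.le] at h1
    rw [max_eq_right hγ.le] at h2
    exact ⟨δ / γ, div_pos_of_neg_of_neg (lt_of_le_of_ne h2 h0) hγ,
      (div_le_one_of_neg hγ).2 h1, (div_mul_cancel₀ _ hγ.ne).symm⟩
  · exact absurd (le_antisymm (by simpa using h2) (by simpa using h1)) h0
  · rw [min_eq_right hγ.le] at h1
    rw [max_eq_left hγ.le] at h2
    exact ⟨δ / γ, div_pos (lt_of_le_of_ne h1 h0.symm) hγ,
      (div_le_one hγ).2 h2, (div_mul_cancel₀ _ hγ.ne').symm⟩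

lemma abs_le_of_mem_Gam {γ δ : ℝ} (h : δ ∈ Gam γ) : |δ| ≤ |γ| := by
  obtain ⟨t, ht, ht1, rfl⟩ := exists_eq_mul_of_mem_Gam h
  rw [abs_mul, abs_of_pos ht]
  exact mul_le_of_le_one_left (abs_nonneg _) ht1

lemma mul_mem_Gam {γ δ c : ℝ} (h : δ ∈ Gam γ) (hc : 0 < c) (hc1 : c ≤ 1) : δ * c ∈ Gam γ := by
  obtain ⟨⟨h1, h2⟩, h0 : δ ≠ 0⟩ := h
  have hmin : min γ 0 ≤ 0 := min_le_right _ _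
  have hmax : 0 ≤ max γ 0 := le_max_right _ _
  exact ⟨⟨by nlinarith, by nlinarith⟩, mul_ne_zero h0 hc.ne'⟩

lemma ip_pos {x y : Fin d → ℝ} (hx : x ∈ stdSimplex ℝ (Fin d)) (hy : ∀ i, 0 < y i) :
    0 < ip x y := by
  obtain ⟨i, -, hi⟩ : ∃ i ∈ Finset.univ, 0 < x i := by
    by_contra! h
    have := Finset.sum_nonpos h
    linarith [hx.2]
  exact Finset.sum_pos' (fun j _ => mul_nonneg (hx.1 j) (hy j).le)
    ⟨i, Finset.mem_univ i, mul_pos hi (hy i)⟩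

lemma Gmap_mem_stdSimplex {x y : Fin d → ℝ} (hx : x ∈ stdSimplex ℝ (Fin d))
    (hy : ∀ i, 0 < y i) : Gmap x y ∈ stdSimplex ℝ (Fin d) := by
  refine ⟨fun i => div_nonneg (mul_nonneg (hx.1 i) (hy i).le) (ip_pos hx hy).le, ?_⟩
  simp only [Gmap, ← Finset.sum_div]
  exact div_self (ip_pos hx hy).ne'

lemma continuous_ip_left (y : Fin d → ℝ) : Continuous fun x => ip x y := by
  unfold ip; fun_prop

lemma measurable_ip_right (x : Fin d → ℝ) : Measurable fun y => ip x y := by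
  unfold ip; fun_prop

/-- The logarithmic return of a portfolio with weights `x` when the assets have logarithmic
returns `ρ`. -/
def logReturn (x ρ : Fin d → ℝ) : ℝ := Real.log (ip x fun i => Real.exp (ρ i))

lemma exists_logReturn_le {x : Fin d → ℝ} (hx : x ∈ stdSimplex ℝ (Fin d)) (ρ : Fin d → ℝ) :
    ∃ i, logReturn x ρ ≤ ρ i := by
  by_contra! h
  have hpos := ip_pos hx fun i => Real.exp_pos (ρ i)
  have hlt : ∀ i, Real.exp (ρ i) < ip x fun i => Real.exp (ρ i) := fun i =>
    (Real.lt_log_iff_exp_lt hpos).1 (h i)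
  have := ip_pos (y := fun i => (ip x fun i => Real.exp (ρ i)) - Real.exp (ρ i)) hx
    fun i => sub_pos.2 (hlt i)
  simp only [ip, mul_sub, Finset.sum_sub_distrib, ← Finset.sum_mul, hx.2] at this
  linarith

lemma exists_le_logReturn {x : Fin d → ℝ} (hx : x ∈ stdSimplex ℝ (Fin d)) (ρ : Fin d → ℝ) :
    ∃ i, ρ i ≤ logReturn x ρ := by
  by_contra! h
  have hpos := ip_pos hx fun i => Real.exp_pos (ρ i)
  have hlt : ∀ i, (ip x fun i => Real.exp (ρ i)) < Real.exp (ρ i) := fun i =>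
    (Real.log_lt_iff_lt_exp hpos).1 (h i)
  have := ip_pos (y := fun i => Real.exp (ρ i) - ip x fun i => Real.exp (ρ i)) hx
    fun i => sub_pos.2 (hlt i)
  simp only [ip, mul_sub, Finset.sum_sub_distrib, ← Finset.sum_mul, hx.2] at this
  linarith

lemma abs_logReturn_le {x : Fin d → ℝ} (hx : x ∈ stdSimplex ℝ (Fin d)) (ρ : Fin d → ℝ) :
    |logReturn x ρ| ≤ ∑ i, |ρ i| := by
  have hsum : ∀ i, |ρ i| ≤ ∑ i, |ρ i| := fun i =>
    Finset.single_le_sum (f := fun i => |ρ i|) (fun j _ => abs_nonneg _) (Finset.mem_univ i)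
  obtain ⟨i, hi⟩ := exists_logReturn_le hx ρ
  obtain ⟨j, hj⟩ := exists_le_logReturn hx ρ
  exact abs_le.2 ⟨by linarith [neg_abs_le (ρ j), hsum j], by linarith [le_abs_self (ρ i), hsum i]⟩

lemma exp_mul_logReturn_le {x : Fin d → ℝ} (hx : x ∈ stdSimplex ℝ (Fin d)) (ρ : Fin d → ℝ)
    (γ : ℝ) : Real.exp (γ * logReturn x ρ) ≤ ∑ i, Real.exp (γ * ρ i) := by
  obtain ⟨i, hi⟩ : ∃ i, γ * logReturn x ρ ≤ γ * ρ i := by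
    rcases le_total 0 γ with hγ | hγ
    · exact (exists_logReturn_le hx ρ).imp fun i hi => mul_le_mul_of_nonneg_left hi hγ
    · exact (exists_le_logReturn hx ρ).imp fun i hi => mul_le_mul_of_nonpos_left hi hγ
  exact (Real.exp_le_exp.2 hi).trans <| Finset.single_le_sum
    (f := fun i => Real.exp (γ * ρ i)) (fun j _ => (Real.exp_pos _).le) (Finset.mem_univ i)

lemma exp_mul_logReturn_le_of_mem_Gam {x : Fin d → ℝ} (hx : x ∈ stdSimplex ℝ (Fin d))
    (ρ : Fin d → ℝ) {γ δ : ℝ} (hδ : δ ∈ Gam γ) :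
    Real.exp (δ * logReturn x ρ) ≤ 1 + ∑ i, Real.exp (γ * ρ i) := by
  obtain ⟨t, ht, ht1, rfl⟩ := exists_eq_mul_of_mem_Gam hδ
  have hexp := exp_mul_logReturn_le hx ρ γ
  rcases le_total (γ * logReturn x ρ) 0 with h | h
  · have : Real.exp (t * γ * logReturn x ρ) ≤ 1 := Real.exp_le_one_iff.2 (by nlinarith)
    linarith [Real.exp_pos (γ * logReturn x ρ)]
  · have : Real.exp (t * γ * logReturn x ρ) ≤ Real.exp (γ * logReturn x ρ) :=
      Real.exp_le_exp.2 (by nlinarith)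
    linarith

lemma continuous_logReturn (ρ : Fin d → ℝ) :
    Continuous fun x : stdSimplex ℝ (Fin d) => logReturn (x : Fin d → ℝ) ρ :=
  ((continuous_ip_left _).comp continuous_subtype_val).log fun x =>
    (ip_pos x.2 fun i => Real.exp_pos (ρ i)).ne'

lemma measurable_logReturn (x : Fin d → ℝ) : Measurable (logReturn x) :=
  Real.measurable_log.comp ((measurable_ip_right x).comp (by fun_prop))

/-- The portfolio weights after the assets with weights `x` have had logarithmic returns `ρ`. -/
def drift (x : stdSimplex ℝ (Fin d)) (ρ : Fin d → ℝ) : stdSimplex ℝ (Fin d) :=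
  ⟨Gmap x fun i => Real.exp (ρ i), Gmap_mem_stdSimplex x.2 fun i => Real.exp_pos (ρ i)⟩

lemma continuous_drift (ρ : Fin d → ℝ) : Continuous fun x => drift x ρ := by
  refine Continuous.subtype_mk (continuous_pi fun i => Continuous.div ?_ ?_ fun x =>
    (ip_pos x.2 fun i => Real.exp_pos (ρ i)).ne') _
  · exact ((continuous_apply i).comp continuous_subtype_val).mul continuous_const
  · exact (continuous_ip_left _).comp continuous_subtype_val

lemma measurable_drift (x : stdSimplex ℝ (Fin d)) : Measurable (drift x) := by
  refine Measurable.subtype_mk (measurable_pi_lambda _ fun i => Measurable.div ?_ ?_)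
  · fun_prop
  · exact (measurable_ip_right _).comp (by fun_prop)

/-- The discounted parameter `δe^{-α}`. -/
def discount {γ α : ℝ} (hα : 0 < α) (δ : Gam γ) : Gam γ :=
  ⟨δ * Real.exp (-α), mul_mem_Gam δ.2 (Real.exp_pos _) (Real.exp_le_one_iff.2 (by linarith))⟩

lemma continuous_discount {γ α : ℝ} (hα : 0 < α) : Continuous (discount (γ := γ) hα) :=
  (continuous_subtype_val.mul continuous_const).subtype_mk _

variable {Ω : Type*} [MeasurableSpace Ω] {P : Measure Ω} [IsProbabilityMeasure P]

lemma integrable_exp_mul_logReturn {x : Fin d → ℝ} (hx : x ∈ stdSimplex ℝ (Fin d)) {γ δ : ℝ}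
    (hδ : δ ∈ Gam γ) {r : Ω → Fin d → ℝ} (hrm : Measurable r)
    (hexp : ∀ i, Integrable (fun ω => Real.exp (γ * r ω i)) P) :
    Integrable (fun ω => Real.exp (δ * logReturn x (r ω))) P := by
  have hM : Integrable (fun ω => 1 + ∑ i, Real.exp (γ * r ω i)) P :=
    (integrable_const 1).add (integrable_finsetSum _ fun i _ => hexp i)
  refine hM.mono' (Real.measurable_exp.comp
    (((measurable_logReturn _).comp hrm).const_mul _)).aestronglyMeasurable (.of_forall fun ω => ?_)
  rw [Real.norm_eq_abs, Real.abs_exp]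
  exact exp_mul_logReturn_le_of_mem_Gam hx (r ω) hδ

/-- A bound, uniform in the portfolio and the risk parameter, for the entropic utility of the
logarithmic return. -/
lemma exists_abs_entropic_logReturn_le {γ : ℝ} (hγ : γ ≠ 0) {r : Ω → Fin d → ℝ}
    (hrm : Measurable r) (hexp : ∀ i, Integrable (fun ω => Real.exp (γ * r ω i)) P)
    (hint : ∀ i, Integrable (fun ω => r ω i) P) :
    ∃ B, ∀ x ∈ stdSimplex ℝ (Fin d), ∀ δ ∈ Gam γ,
      |entropic δ P fun ω => logReturn x (r ω)| ≤ B := by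
  set A := ∫ ω, ∑ i, |r ω i| ∂P
  set M := ∫ ω, ∑ i, Real.exp (γ * r ω i) ∂P
  refine ⟨|γ|⁻¹ * (|γ| * A + |Real.log M|), fun x hx δ hδ => ?_⟩
  have hm : Measurable fun ω => logReturn x (r ω) := (measurable_logReturn x).comp hrm
  have hAi : Integrable (fun ω => ∑ i, |r ω i|) P := integrable_finsetSum _ fun i _ => (hint i).abs
  have hMi : Integrable (fun ω => ∑ i, Real.exp (γ * r ω i)) P :=
    integrable_finsetSum _ fun i _ => hexp i
  have hL : Integrable (fun ω => logReturn x (r ω)) P :=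
    hAi.mono' hm.aestronglyMeasurable (.of_forall fun ω => abs_logReturn_le hx (r ω))
  have hγL := integrable_exp_mul_logReturn hx
    (show γ ∈ Gam γ from ⟨⟨min_le_left _ _, le_max_left _ _⟩, hγ⟩) hrm hexp
  have hδL := integrable_exp_mul_logReturn hx hδ hrm hexp
  have hmean : |∫ ω, γ * logReturn x (r ω) ∂P| ≤ |γ| * A := by
    rw [integral_const_mul, abs_mul]
    refine mul_le_mul_of_nonneg_left (abs_integral_le_integral_abs.trans ?_) (abs_nonneg _)
    exact integral_mono hL.abs hAi fun ω => abs_logReturn_le hx (r ω)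
  obtain ⟨t, ht, ht1, rfl⟩ := exists_eq_mul_of_mem_Gam hδ
  simp only [mul_assoc] at hδL
  have hlow := mul_integral_le_log_integral_exp (hL.const_mul γ) hδL
  have hup := log_integral_exp_le_mul_log ht.le ht1 hγL hδL
    (integral_mono hγL hMi fun ω => exp_mul_logReturn_le hx (r ω) γ)
  have hA : 0 ≤ |γ| * A := (abs_nonneg _).trans hmean
  have hlog : |Real.log (∫ ω, Real.exp (t * (γ * logReturn x (r ω))) ∂P)| ≤
      t * (|γ| * A + |Real.log M|) := by
    refine abs_le.2 ⟨?_, ?_⟩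
    · refine le_trans ?_ hlow
      rw [← mul_neg]
      exact mul_le_mul_of_nonneg_left
        (by linarith [(abs_le.1 hmean).1, abs_nonneg (Real.log M)]) ht.le
    · exact hup.trans (mul_le_mul_of_nonneg_left (by linarith [le_abs_self (Real.log M)]) ht.le)
  have habs : |1 / (t * γ)| = |γ|⁻¹ * t⁻¹ := by
    rw [one_div, abs_inv, abs_mul, abs_of_pos ht, mul_inv, mul_comm]
  simp only [entropic, mul_assoc]
  rw [abs_mul, habs, mul_assoc]
  refine mul_le_mul_of_nonneg_left ?_ (by positivity)
  rw [inv_mul_le_iff₀ ht]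
  exact hlog

end Portfolio

lemma abs_ciSup_sub_ciSup_le {ι : Type*} [Nonempty ι] {f g : ι → ℝ} {c : ℝ}
    (hf : BddAbove (range f)) (hg : BddAbove (range g)) (h : ∀ i, |f i - g i| ≤ c) :
    |(⨆ i, f i) - ⨆ i, g i| ≤ c := by
  rw [abs_sub_le_iff, sub_le_iff_le_add, sub_le_iff_le_add]
  exact ⟨ciSup_le fun i => by linarith [(abs_le.1 (h i)).2, le_ciSup hg i],
    ciSup_le fun i => by linarith [(abs_le.1 (h i)).1, le_ciSup hf i]⟩

section Bellman

open scoped BoundedContinuousFunction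

variable {d : ℕ} {Ω : Type*} {γ α : ℝ} {s : (Fin d → ℝ) → (Fin d → ℝ) → ℝ} {r : Ω → Fin d → ℝ}

/-- The payoff of rebalancing from `z.1` to `π'`, with continuation value `u`. -/
def payoff (s : (Fin d → ℝ) → (Fin d → ℝ) → ℝ) (r : Ω → Fin d → ℝ) (hα : 0 < α)
    (u : stdSimplex ℝ (Fin d) × Gam γ → ℝ) (z : stdSimplex ℝ (Fin d) × Gam γ)
    (π' : stdSimplex ℝ (Fin d)) (ω : Ω) : ℝ :=
  logReturn π' (r ω) + Real.log (s z.1 π') +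
    Real.exp (-α) * u (drift π' (r ω), discount hα z.2)

lemma continuous_payoff (hs0 : ∀ x y : stdSimplex ℝ (Fin d), s x y ≠ 0)
    (hsc : Continuous fun p : stdSimplex ℝ (Fin d) × stdSimplex ℝ (Fin d) => s p.1 p.2)
    (hα : 0 < α) (u : stdSimplex ℝ (Fin d) × Gam γ →ᵇ ℝ) (ω : Ω) :
    Continuous fun q : (stdSimplex ℝ (Fin d) × Gam γ) × stdSimplex ℝ (Fin d) =>
      payoff s r hα u q.1 q.2 ω := by
  refine Continuous.add (Continuous.add ((continuous_logReturn _).comp continuous_snd) ?_)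
    (continuous_const.mul (u.continuous.comp ?_))
  · exact (hsc.comp ((continuous_fst.comp continuous_fst).prodMk continuous_snd)).log
      fun q => hs0 _ _
  · exact ((continuous_drift _).comp continuous_snd).prodMk
      ((continuous_discount hα).comp (continuous_snd.comp continuous_fst))

lemma abs_payoff_sub_logReturn_le {c : ℝ}
    (hs : ∀ x y : stdSimplex ℝ (Fin d), |Real.log (s x y)| ≤ c) (hα : 0 < α)
    (u : stdSimplex ℝ (Fin d) × Gam γ →ᵇ ℝ) (z : stdSimplex ℝ (Fin d) × Gam γ)
    (π' : stdSimplex ℝ (Fin d)) (ω : Ω) :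
    |payoff s r hα u z π' ω - logReturn π' (r ω)| ≤ c + ‖u‖ := by
  have hu := u.norm_coe_le_norm (drift π' (r ω), discount hα z.2)
  have h1 : |Real.exp (-α) * u (drift π' (r ω), discount hα z.2)| ≤ ‖u‖ := by
    rw [abs_mul, Real.abs_exp]
    exact (mul_le_of_le_one_left (abs_nonneg _) (Real.exp_le_one_iff.2 (by linarith))).trans hu
  rw [payoff, add_assoc, add_sub_cancel_left]
  exact (abs_add_le _ _).trans (add_le_add (hs _ _) h1)

lemma exp_mul_payoff_le {c : ℝ}
    (hs : ∀ x y : stdSimplex ℝ (Fin d), |Real.log (s x y)| ≤ c) (hα : 0 < α)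
    (u : stdSimplex ℝ (Fin d) × Gam γ →ᵇ ℝ) (z : stdSimplex ℝ (Fin d) × Gam γ)
    (π' : stdSimplex ℝ (Fin d)) (ω : Ω) :
    Real.exp (z.2 * payoff s r hα u z π' ω) ≤
      Real.exp (|γ| * (c + ‖u‖)) * (1 + ∑ i, Real.exp (γ * r ω i)) := by
  have hb := abs_payoff_sub_logReturn_le (r := r) hs hα u z π' ω
  have hδ : (z.2 : ℝ) * (payoff s r hα u z π' ω - logReturn π' (r ω)) ≤ |γ| * (c + ‖u‖) := by
    refine (le_abs_self _).trans ?_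
    rw [abs_mul]
    exact mul_le_mul (abs_le_of_mem_Gam z.2.2) hb (abs_nonneg _) (abs_nonneg _)
  calc Real.exp (z.2 * payoff s r hα u z π' ω)
      = Real.exp (z.2 * (payoff s r hα u z π' ω - logReturn π' (r ω))) *
          Real.exp (z.2 * logReturn π' (r ω)) := by rw [← Real.exp_add]; ring_nf
    _ ≤ _ := mul_le_mul (Real.exp_le_exp.2 hδ)
        (exp_mul_logReturn_le_of_mem_Gam π'.2 (r ω) z.2.2) (Real.exp_pos _).le (Real.exp_pos _).le

variable [MeasurableSpace Ω] {P : Measure Ω} [IsProbabilityMeasure P]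

lemma measurable_payoff (hrm : Measurable r) (hα : 0 < α)
    (u : stdSimplex ℝ (Fin d) × Gam γ →ᵇ ℝ) (z : stdSimplex ℝ (Fin d) × Gam γ)
    (π' : stdSimplex ℝ (Fin d)) : Measurable (payoff s r hα u z π') :=
  (((measurable_logReturn _).comp hrm).add_const _).add <| Measurable.const_mul
    (u.continuous.measurable.comp (((measurable_drift π').comp hrm).prodMk measurable_const)) _

lemma integrable_exp_mul_payoff_bound
    (hexp : ∀ i, Integrable (fun ω => Real.exp (γ * r ω i)) P) (C : ℝ) :
    Integrable (fun ω => C * (1 + ∑ i, Real.exp (γ * r ω i))) P :=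
  ((integrable_const 1).add (integrable_finsetSum _ fun i _ => hexp i)).const_mul C

lemma integrable_exp_mul_payoff {c : ℝ}
    (hs : ∀ x y : stdSimplex ℝ (Fin d), |Real.log (s x y)| ≤ c) (hrm : Measurable r)
    (hexp : ∀ i, Integrable (fun ω => Real.exp (γ * r ω i)) P) (hα : 0 < α)
    (u : stdSimplex ℝ (Fin d) × Gam γ →ᵇ ℝ) (z : stdSimplex ℝ (Fin d) × Gam γ)
    (π' : stdSimplex ℝ (Fin d)) :
    Integrable (fun ω => Real.exp (z.2 * payoff s r hα u z π' ω)) P :=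
  (integrable_exp_mul_payoff_bound hexp _).mono'
    (Real.measurable_exp.comp ((measurable_payoff hrm hα u z π').const_mul _)).aestronglyMeasurable
    (.of_forall fun ω => by
      rw [Real.norm_eq_abs, Real.abs_exp]; exact exp_mul_payoff_le hs hα u z π' ω)

lemma exists_abs_entropic_payoff_le {c : ℝ}
    (hs : ∀ x y : stdSimplex ℝ (Fin d), |Real.log (s x y)| ≤ c) (hγ : γ ≠ 0) (hrm : Measurable r)
    (hexp : ∀ i, Integrable (fun ω => Real.exp (γ * r ω i)) P)
    (hint : ∀ i, Integrable (fun ω => r ω i) P) (hα : 0 < α)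
    (u : stdSimplex ℝ (Fin d) × Gam γ →ᵇ ℝ) :
    ∃ B, ∀ z π', |entropic z.2 P (payoff s r hα u z π')| ≤ B := by
  obtain ⟨B, hB⟩ := exists_abs_entropic_logReturn_le hγ hrm hexp hint
  refine ⟨c + ‖u‖ + B, fun z π' => ?_⟩
  have h1 := abs_entropic_sub_entropic_le z.2.2.2
    (integrable_exp_mul_payoff hs hrm hexp hα u z π')
    (integrable_exp_mul_logReturn π'.2 z.2.2 hrm hexp)
    (abs_payoff_sub_logReturn_le hs hα u z π')
  have h2 : |entropic z.2 P fun ω => logReturn π'.1 (r ω)| ≤ B := hB π' π'.2 z.2 z.2.2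
  rw [abs_le] at *
  constructor <;> linarith [h1.1, h1.2, h2.1, h2.2]

/-- The Bellman operator for `v(π,δ)/δ`, which is a contraction. -/
def normalizedBellman (P : Measure Ω) (s : (Fin d → ℝ) → (Fin d → ℝ) → ℝ) (r : Ω → Fin d → ℝ)
    (hα : 0 < α) (u : stdSimplex ℝ (Fin d) × Gam γ → ℝ) (z : stdSimplex ℝ (Fin d) × Gam γ) : ℝ :=
  ⨆ π', entropic z.2 P (payoff s r hα u z π')

lemma exists_eq_normalizedBellman {c : ℝ} [Nonempty (stdSimplex ℝ (Fin d))]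
    (hs : ∀ x y : stdSimplex ℝ (Fin d), |Real.log (s x y)| ≤ c)
    (hs0 : ∀ x y : stdSimplex ℝ (Fin d), s x y ≠ 0)
    (hsc : Continuous fun p : stdSimplex ℝ (Fin d) × stdSimplex ℝ (Fin d) => s p.1 p.2)
    (hγ : γ ≠ 0) (hrm : Measurable r)
    (hexp : ∀ i, Integrable (fun ω => Real.exp (γ * r ω i)) P)
    (hint : ∀ i, Integrable (fun ω => r ω i) P) (hα : 0 < α) :
    ∃ u : stdSimplex ℝ (Fin d) × Gam γ →ᵇ ℝ, ∀ z, u z = normalizedBellman P s r hα u z := by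
  have hbdd : ∀ (u : stdSimplex ℝ (Fin d) × Gam γ →ᵇ ℝ) z,
      BddAbove (range fun π' => entropic z.2 P (payoff s r hα u z π')) := fun u z => by
    obtain ⟨B, hB⟩ := exists_abs_entropic_payoff_le hs hγ hrm hexp hint hα u
    exact ⟨B, forall_mem_range.2 fun π' => (abs_le.1 (hB z π')).2⟩
  have hcont : ∀ u : stdSimplex ℝ (Fin d) × Gam γ →ᵇ ℝ,
      Continuous (normalizedBellman P s r hα u) := fun u => by
    have hjoint := continuous_entropic (P := P)
      (X := (stdSimplex ℝ (Fin d) × Gam γ) × stdSimplex ℝ (Fin d))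
      (D := fun q => q.1.2) (Φ := fun q => payoff s r hα u q.1 q.2)
      (by fun_prop) (fun q => q.1.2.2.2)
      (fun q => measurable_payoff hrm hα u q.1 q.2) (continuous_payoff hs0 hsc hα u)
      (integrable_exp_mul_payoff_bound hexp _)
      (fun q ω => exp_mul_payoff_le hs hα u q.1 q.2 ω)
    have h := isCompact_univ.continuous_sSup (K := (univ : Set (stdSimplex ℝ (Fin d))))
      (f := fun (z : stdSimplex ℝ (Fin d) × Gam γ) π' =>
        entropic z.2 P (payoff s r hα u z π')) hjoint
    simp only [image_univ] at h
    exact h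
  have hbound : ∀ u : stdSimplex ℝ (Fin d) × Gam γ →ᵇ ℝ,
      ∃ B, ∀ z, ‖normalizedBellman P s r hα u z‖ ≤ B := fun u => by
    obtain ⟨B, hB⟩ := exists_abs_entropic_payoff_le hs hγ hrm hexp hint hα u
    refine ⟨B, fun z => abs_le.2 ⟨?_, ciSup_le fun π' => (abs_le.1 (hB z π')).2⟩⟩
    obtain ⟨π'⟩ := ‹Nonempty (stdSimplex ℝ (Fin d))›
    exact (abs_le.1 (hB z π')).1.trans (le_ciSup (hbdd u z) π')
  choose B hB using hbound
  let T : (stdSimplex ℝ (Fin d) × Gam γ →ᵇ ℝ) → (stdSimplex ℝ (Fin d) × Gam γ →ᵇ ℝ) := fun u =>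
    .ofNormedAddCommGroup (normalizedBellman P s r hα u) (hcont u) (B u) (hB u)
  have hT : ContractingWith (Real.exp (-α)).toNNReal T := by
    refine ⟨Real.toNNReal_lt_one.2 (Real.exp_lt_one_iff.2 (by linarith)),
      LipschitzWith.of_dist_le_mul fun u v => ?_⟩
    rw [Real.coe_toNNReal _ (Real.exp_pos _).le]
    refine (BoundedContinuousFunction.dist_le (by positivity)).2 fun z => ?_
    refine abs_ciSup_sub_ciSup_le (hbdd u z) (hbdd v z) fun π' => ?_
    refine abs_entropic_sub_entropic_le z.2.2.2
      (integrable_exp_mul_payoff hs hrm hexp hα u z π')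
      (integrable_exp_mul_payoff hs hrm hexp hα v z π') fun ω => ?_
    rw [payoff, payoff, add_sub_add_left_eq_sub, ← mul_sub, abs_mul, Real.abs_exp]
    exact mul_le_mul_of_nonneg_left (u.dist_coe_le_dist (g := v) _)
      (Real.exp_pos _).le
  exact ⟨ContractingWith.fixedPoint T hT, fun z =>
    (DFunLike.congr_fun hT.fixedPoint_isFixedPt z).symm⟩

end Bellman

/-- Theorem `th:discounted`: under (A.1), for each `α > 0` there exists a
bounded continuous function `v_α : S × Γ → ℝ` solving the discounted Bellman equation
`v_α(π,δ) = δ ⨆_{π' ∈ S} μ^δ(ln⟨π',w⟩ + ln s(π,π') + δ⁻¹ v_α(G(π',w), δe^{-α}))`. -/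
theorem discounted_bellman_exists {d : ℕ} (hd : 0 < d) {Ω : Type*} [MeasurableSpace Ω]
    (P : Measure Ω) [IsProbabilityMeasure P]
    (st : ℝ) (hst : st ∈ Ioo (0 : ℝ) 1)
    (s : (Fin d → ℝ) → (Fin d → ℝ) → ℝ)
    (hs : ∀ x ∈ stdSimplex ℝ (Fin d), ∀ y ∈ stdSimplex ℝ (Fin d), s x y ∈ Icc st 1)
    (hscont : ContinuousOn (fun p : (Fin d → ℝ) × (Fin d → ℝ) => s p.1 p.2)
      (stdSimplex ℝ (Fin d) ×ˢ stdSimplex ℝ (Fin d)))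
    (γ : ℝ) (hγ : γ ≠ 0) (r : Ω → Fin d → ℝ) (hrm : Measurable r)
    (hA1exp : ∀ i, Integrable (fun ω => Real.exp (γ * r ω i)) P)
    (hA1int : ∀ i, Integrable (fun ω => r ω i) P)
    (α : ℝ) (hα : 0 < α) :
    ∃ v : (Fin d → ℝ) → ℝ → ℝ,
      (∃ C : ℝ, ∀ π ∈ stdSimplex ℝ (Fin d), ∀ δ ∈ Gam γ, |v π δ| ≤ C) ∧
      ContinuousOn (fun p : (Fin d → ℝ) × ℝ => v p.1 p.2)
        (stdSimplex ℝ (Fin d) ×ˢ Gam γ) ∧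
      ∀ π ∈ stdSimplex ℝ (Fin d), ∀ δ ∈ Gam γ, v π δ = TOp P s r α v π δ := by
  classical
  have : Nonempty (stdSimplex ℝ (Fin d)) := ⟨⟨_, single_mem_stdSimplex ℝ ⟨0, hd⟩⟩⟩
  have hs0 : ∀ x y : stdSimplex ℝ (Fin d), s x y ≠ 0 := fun x y =>
    (hst.1.trans_le (hs x x.2 y y.2).1).ne'
  have hslog : ∀ x y : stdSimplex ℝ (Fin d), |Real.log (s x y)| ≤ -Real.log st := fun x y => by
    obtain ⟨h1, h2⟩ := hs x x.2 y y.2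
    rw [abs_of_nonpos (Real.log_nonpos (hst.1.le.trans h1) h2)]
    exact neg_le_neg (Real.log_le_log hst.1 h1)
  have hsc : Continuous fun p : stdSimplex ℝ (Fin d) × stdSimplex ℝ (Fin d) => s p.1 p.2 :=
    hscont.comp_continuous (f := fun p : stdSimplex ℝ (Fin d) × stdSimplex ℝ (Fin d) =>
      ((p.1 : Fin d → ℝ), (p.2 : Fin d → ℝ))) (by fun_prop) fun p => ⟨p.1.2, p.2.2⟩
  obtain ⟨u, hu⟩ := exists_eq_normalizedBellman hslog hs0 hsc hγ hrm hA1exp hA1int hα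
  let v : (Fin d → ℝ) → ℝ → ℝ := fun π δ =>
    if h : π ∈ stdSimplex ℝ (Fin d) ∧ δ ∈ Gam γ then δ * u (⟨π, h.1⟩, ⟨δ, h.2⟩) else 0
  have hv : ∀ (π : stdSimplex ℝ (Fin d)) (δ : Gam γ), v π δ = δ * u (π, δ) := fun π δ =>
    dif_pos ⟨π.2, δ.2⟩
  refine ⟨v, ⟨|γ| * ‖u‖, fun π hπ δ hδ => ?_⟩, ?_, fun π hπ δ hδ => ?_⟩
  · rw [show v π δ = _ from hv ⟨π, hπ⟩ ⟨δ, hδ⟩, abs_mul]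
    exact mul_le_mul (abs_le_of_mem_Gam hδ) (u.norm_coe_le_norm _) (abs_nonneg _) (abs_nonneg _)
  · rw [continuousOn_iff_continuous_domRestrict]
    have hc : Continuous fun p : (stdSimplex ℝ (Fin d) ×ˢ Gam γ : Set ((Fin d → ℝ) × ℝ)) =>
        (p.1.2 : ℝ) * u (⟨p.1.1, p.2.1⟩, ⟨p.1.2, p.2.2⟩) := by fun_prop
    exact hc.congr fun p => (hv ⟨p.1.1, p.2.1⟩ ⟨p.1.2, p.2.2⟩).symm
  · rw [show v π δ = _ from hv ⟨π, hπ⟩ ⟨δ, hδ⟩, hu, TOp, normalizedBellman, iSup, image_eq_range]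
    have hpay : ∀ π' : stdSimplex ℝ (Fin d),
        payoff s r hα u (⟨π, hπ⟩, ⟨δ, hδ⟩) π' = fun ω =>
          Real.log (ip π' (fun i => Real.exp (r ω i))) + Real.log (s π π') +
            δ⁻¹ * v (Gmap π' (fun i => Real.exp (r ω i))) (δ * Real.exp (-α)) := fun π' => by
      have hδ0 : δ ≠ 0 := hδ.2
      ext ω
      rw [show v (Gmap π' fun i => Real.exp (r ω i)) (δ * Real.exp (-α)) = δ * Real.exp (-α) *
        u (drift π' (r ω), discount hα ⟨δ, hδ⟩) from hv (drift π' (r ω)) (discount hα ⟨δ, hδ⟩), mul_assoc, inv_mul_cancel_left₀ hδ0]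
      rfl
    simp only [hpay]
    rfl
end
end

section
/- Let X be a nonempty set and v : X → ℝ a bounded function. Then inf_{c ∈ ℝ} sup_{x ∈ X} |v(x) + c| = sup_{x, y ∈ X} (v(x) − v(y))/2; that is, the infimum over additive constants of the supremum norm of v + c equals the span seminorm ‖v‖_sp of v. -/
open Set

noncomputable section

/-- For a bounded function `v` on a nonempty set `X`, the infimum over
additive constants `c` of the supremum norm of `v + c` equals the span seminorm of `v`. -/
theorem span_seminorm_eq_inf_sup_norm {X : Type*} [Nonempty X]
    (v : X → ℝ) (hv : ∃ C : ℝ, ∀ x, |v x| ≤ C) :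
    (⨅ c : ℝ, ⨆ x : X, |v x + c|) = ⨆ p : X × X, (v p.1 - v p.2) / 2 := by
  obtain ⟨C, hC⟩ := hv
  have bdd_range : BddAbove (range v) :=
    ⟨C, forall_mem_range.2 fun x => (abs_le.1 (hC x)).2⟩
  have bdd_abs (c : ℝ) : BddAbove (range fun x => |v x + c|) :=
    ⟨C + |c|, forall_mem_range.2 fun x => (abs_add_le _ _).trans (by gcongr; exact hC x)⟩
  have bdd_span : BddAbove (range fun p : X × X => (v p.1 - v p.2) / 2) :=
    ⟨C, forall_mem_range.2 fun p => by
      linarith [(abs_le.1 (hC p.1)).2, (abs_le.1 (hC p.2)).1]⟩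
  have bdd_below : BddBelow (range fun c : ℝ => ⨆ x : X, |v x + c|) :=
    ⟨0, forall_mem_range.2 fun c => Real.iSup_nonneg fun x => abs_nonneg _⟩
  apply le_antisymm
  · refine ciInf_le_of_le bdd_below
      ((⨆ p : X × X, (v p.1 - v p.2) / 2) - ⨆ x, v x) (ciSup_le fun x => abs_le.2 ⟨?_, ?_⟩)
    · have : ⨆ y, v y ≤ v x + 2 * ⨆ p : X × X, (v p.1 - v p.2) / 2 :=
        ciSup_le fun y => by linarith [le_ciSup bdd_span (y, x)]
      linarith
    · linarith [le_ciSup bdd_range x]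
  · refine le_ciInf fun c => ciSup_le fun p => ?_
    linarith [le_ciSup (bdd_abs c) p.1, le_ciSup (bdd_abs c) p.2,
      le_abs_self (v p.1 + c), neg_abs_le (v p.2 + c)]
end
end

section
/- Let γ < 0, assume (A.1), and fix δ ∈ (0, 1/d). Then for every bounded continuous function v : S → ℝ and all π, π̄ ∈ S: |(T_δ v)(π) − (T_δ v)(π̄)| ≤ |γ| · sup_{π' ∈ S_δ} | ln( s(π, π') / s(π̄, π') ) | ≤ |γ| · |ln s̃|; in particular ‖T_δ v‖_sp ≤ −|γ| ln s̃. -/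
open MeasureTheory Set

noncomputable section

/-- `S_δ`, the set of allocations in the simplex with all weights at least `δ`. -/
def Sdel {d : ℕ} (δ : ℝ) : Set (Fin d → ℝ) := {π ∈ stdSimplex ℝ (Fin d) | ∀ i, δ ≤ π i}

/-- The restricted Bellman operator
`(T_δ v)(π) = sup_{π' ∈ S_δ} [γ ln s(π,π') + ln E[exp(γ ln⟨π',w⟩ + v(G(π',w)))]]`. -/
def Tdel {d : ℕ} {Ω : Type*} [MeasurableSpace Ω] (P : Measure Ω) (γ : ℝ)
    (s : (Fin d → ℝ) → (Fin d → ℝ) → ℝ) (r : Ω → Fin d → ℝ) (δ : ℝ)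
    (v : (Fin d → ℝ) → ℝ) (π : Fin d → ℝ) : ℝ :=
  sSup ((fun π' => γ * Real.log (s π π') +
      Real.log (∫ ω, Real.exp (γ * Real.log (ip π' (fun i => Real.exp (r ω i))) +
        v (Gmap π' (fun i => Real.exp (r ω i)))) ∂P)) '' Sdel δ)

/-- Span seminorm `‖v‖_sp = sup_{π,π' ∈ S} (v(π) − v(π'))/2`. -/
def spanSemi {d : ℕ} (f : (Fin d → ℝ) → ℝ) : ℝ :=
  sSup {y | ∃ π ∈ stdSimplex ℝ (Fin d), ∃ π' ∈ stdSimplex ℝ (Fin d), y = (f π - f π') / 2}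

/-- If two functions stay within `M` of each other on `A`, then so do their suprema over `A`; in
the unbounded and empty cases both real suprema are `0`. -/
theorem abs_sSup_image_sub_sSup_image_le {ι : Type*} {A : Set ι} {f g : ι → ℝ} {M : ℝ}
    (hM : 0 ≤ M) (h : ∀ x ∈ A, |f x - g x| ≤ M) :
    |sSup (f '' A) - sSup (g '' A)| ≤ M := by
  rcases A.eq_empty_or_nonempty with rfl | hA
  · simpa using hM
  by_cases hf : BddAbove (f '' A)
  · have hg : BddAbove (g '' A) := by
      obtain ⟨B, hB⟩ := hf
      refine ⟨B + M, forall_mem_image.2 fun x hx => ?_⟩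
      linarith [hB (mem_image_of_mem f hx), (abs_le.1 (h x hx)).1]
    have h₁ : sSup (f '' A) ≤ sSup (g '' A) + M :=
      csSup_le (hA.image f) <| forall_mem_image.2 fun x hx => by
        linarith [le_csSup hg (mem_image_of_mem g hx), (abs_le.1 (h x hx)).2]
    have h₂ : sSup (g '' A) ≤ sSup (f '' A) + M :=
      csSup_le (hA.image g) <| forall_mem_image.2 fun x hx => by
        linarith [le_csSup hf (mem_image_of_mem f hx), (abs_le.1 (h x hx)).1]
    exact abs_le.2 ⟨by linarith, by linarith⟩
  · have hg : ¬ BddAbove (g '' A) := by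
      rintro ⟨B, hB⟩
      refine hf ⟨B + M, forall_mem_image.2 fun x hx => ?_⟩
      linarith [hB (mem_image_of_mem g hx), (abs_le.1 (h x hx)).2]
    simpa [Real.sSup_of_not_bddAbove hf, Real.sSup_of_not_bddAbove hg] using hM

/-- The logarithm of a ratio of two numbers in `[c, 1]` is at most `|log c|` in absolute value. -/
theorem abs_log_div_le_of_mem_Icc {c a b : ℝ} (hc : 0 < c) (ha : a ∈ Icc c 1)
    (hb : b ∈ Icc c 1) : |Real.log (a / b)| ≤ |Real.log c| := by
  have ha0 : 0 < a := hc.trans_le ha.1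
  have hb0 : 0 < b := hc.trans_le hb.1
  rw [Real.log_div ha0.ne' hb0.ne']
  refine le_trans (abs_le.2 ⟨?_, ?_⟩) (neg_le_abs _) <;>
    linarith [Real.log_le_log hc ha.1, Real.log_le_log hc hb.1,
      Real.log_nonpos ha0.le ha.2, Real.log_nonpos hb0.le hb.2]

/-- for `γ < 0`, under (A.1), for `δ ∈ (0, 1/d)` and every bounded
continuous `v : S → ℝ`: `|T_δv(π) − T_δv(π̄)| ≤ |γ| sup_{π' ∈ S_δ} |ln(s(π,π')/s(π̄,π'))|
≤ |γ| |ln s̃|`; in particular `‖T_δ v‖_sp ≤ −|γ| ln s̃`. -/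
theorem restricted_bellman_span_bound {d : ℕ} (hd : 0 < d) {Ω : Type*} [MeasurableSpace Ω]
    (P : Measure Ω) [IsProbabilityMeasure P]
    (st : ℝ) (hst : st ∈ Ioo (0 : ℝ) 1)
    (s : (Fin d → ℝ) → (Fin d → ℝ) → ℝ)
    (hs : ∀ x ∈ stdSimplex ℝ (Fin d), ∀ y ∈ stdSimplex ℝ (Fin d), s x y ∈ Icc st 1)
    (hscont : ContinuousOn (fun p : (Fin d → ℝ) × (Fin d → ℝ) => s p.1 p.2)
      (stdSimplex ℝ (Fin d) ×ˢ stdSimplex ℝ (Fin d)))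
    (γ : ℝ) (hγ : γ < 0) (r : Ω → Fin d → ℝ) (hrm : Measurable r)
    (hA1exp : ∀ i, Integrable (fun ω => Real.exp (γ * r ω i)) P)
    (hA1int : ∀ i, Integrable (fun ω => r ω i) P)
    (δ : ℝ) (hδ : δ ∈ Ioo (0 : ℝ) (1 / d))
    (v : (Fin d → ℝ) → ℝ)
    (hvb : ∃ C : ℝ, ∀ π ∈ stdSimplex ℝ (Fin d), |v π| ≤ C)
    (hvc : ContinuousOn v (stdSimplex ℝ (Fin d))) :
    (∀ π ∈ stdSimplex ℝ (Fin d), ∀ π_bar ∈ stdSimplex ℝ (Fin d),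
      |Tdel P γ s r δ v π - Tdel P γ s r δ v π_bar| ≤
          |γ| * sSup ((fun π' => |Real.log (s π π' / s π_bar π')|) '' Sdel δ) ∧
        |γ| * sSup ((fun π' => |Real.log (s π π' / s π_bar π')|) '' Sdel δ) ≤
          |γ| * |Real.log st|) ∧
      spanSemi (Tdel P γ s r δ v) ≤ -|γ| * Real.log st := by
  have hlog : ∀ π ∈ stdSimplex ℝ (Fin d), ∀ π_bar ∈ stdSimplex ℝ (Fin d),
      ∀ π' ∈ Sdel δ, |Real.log (s π π' / s π_bar π')| ≤ |Real.log st| :=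
    fun π hπ π_bar hπ_bar π' hπ' =>
      abs_log_div_le_of_mem_Icc hst.1 (hs π hπ π' hπ'.1) (hs π_bar hπ_bar π' hπ'.1)
  have main : ∀ π ∈ stdSimplex ℝ (Fin d), ∀ π_bar ∈ stdSimplex ℝ (Fin d),
      |Tdel P γ s r δ v π - Tdel P γ s r δ v π_bar| ≤
          |γ| * sSup ((fun π' => |Real.log (s π π' / s π_bar π')|) '' Sdel δ) ∧
        |γ| * sSup ((fun π' => |Real.log (s π π' / s π_bar π')|) '' Sdel δ) ≤
          |γ| * |Real.log st| := by
    intro π hπ π_bar hπ_bar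
    have hub : ∀ y ∈ (fun π' => |Real.log (s π π' / s π_bar π')|) '' Sdel δ,
        y ≤ |Real.log st| := forall_mem_image.2 fun π' => hlog π hπ π_bar hπ_bar π'
    refine ⟨abs_sSup_image_sub_sSup_image_le (mul_nonneg (abs_nonneg γ)
        (Real.sSup_nonneg (forall_mem_image.2 fun _ _ => abs_nonneg _))) fun π' hπ' => ?_,
      mul_le_mul_of_nonneg_left (Real.sSup_le hub (abs_nonneg _)) (abs_nonneg γ)⟩
    rw [add_sub_add_right_eq_sub, ← mul_sub,
      ← Real.log_div (hst.1.trans_le (hs π hπ π' hπ'.1).1).ne'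
        (hst.1.trans_le (hs π_bar hπ_bar π' hπ'.1).1).ne', abs_mul]
    exact mul_le_mul_of_nonneg_left (le_csSup ⟨_, hub⟩ (mem_image_of_mem _ hπ')) (abs_nonneg γ)
  refine ⟨main, ?_⟩
  have hst_log : |γ| * |Real.log st| = -|γ| * Real.log st := by
    rw [abs_of_neg (Real.log_neg hst.1 hst.2)]
    ring
  have hnonneg : 0 ≤ |γ| * |Real.log st| := by positivity
  rw [← hst_log]
  refine Real.sSup_le ?_ hnonneg
  rintro _ ⟨π, hπ, π', hπ', rfl⟩
  have hππ' := main π hπ π' hπ'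
  linarith [le_abs_self (Tdel P γ s r δ v π - Tdel P γ s r δ v π')]
end
end
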